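/- (Direct-sum majorization entropic uncertainty relation, Tsallis case) For any density matrix ρ, any d×d unitary matrix U relating two orthonormal bases, the induced probability vectors p and q, and any α > 0 with α ≠ 1, one has T_α(p) + T_α(q) ≥ T_α(W), where W = (s₁, s₂−s₁, …, s_d−s_{d−1}). -/

import Mathlib

open scoped BigOperators Matrix ComplexConjugate ComplexOrder

/-- Shannon entropy of a finite real vector (natural logarithm). -/
noncomputable def shannonEntropy {n : Type*} [Fintype n] (x : n → ℝ) : ℝ :=
  -∑ i, x i * Real.log (x i)

/-- Von Neumann entropy of a Hermitian matrix, `-∑ λᵢ ln λᵢ`. -/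
noncomputable def vonNeumannEntropy {d : ℕ} {ρ : Matrix (Fin d) (Fin d) ℂ}
    (hρ : ρ.IsHermitian) : ℝ :=
  -∑ i, hρ.eigenvalues i * Real.log (hρ.eigenvalues i)

/-- Tsallis (Havrda–Charvát) entropy of order `α ≠ 1`. -/
noncomputable def tsallisEntropy {n : Type*} [Fintype n] (α : ℝ) (x : n → ℝ) : ℝ :=
  (1 / (1 - α)) * (∑ i, x i ^ α - 1)

/-- The operator norm (largest singular value) of the submatrix of `U` with rows `I`
and columns `J`, expressed as the supremum of `|⟨x, U y⟩|` over unit vectors supported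
on `I` resp. `J`. -/
noncomputable def subOpNorm {d : ℕ} (U : Matrix (Fin d) (Fin d) ℂ)
    (I J : Finset (Fin d)) : ℝ :=
  sSup { r : ℝ | ∃ (x : I → ℂ) (y : J → ℂ),
    (∑ i, ‖x i‖ ^ 2 = 1) ∧ (∑ j, ‖y j‖ ^ 2 = 1) ∧
    r = ‖∑ i : I, ∑ j : J, (starRingEnd ℂ) (x i) * U i.1 j.1 * y j‖ }

/-- `sCoef U k` is the coefficient `s_k`: the maximal operator norm of a submatrix of `U`
of class `k`, i.e. with `#rows + #cols = k + 1` (for `k = 0` the set is empty and the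
supremum equals `0`). -/
noncomputable def sCoef {d : ℕ} (U : Matrix (Fin d) (Fin d) ℂ) (k : ℕ) : ℝ :=
  sSup { r : ℝ | ∃ I J : Finset (Fin d), I.Nonempty ∧ J.Nonempty ∧
    I.card + J.card = k + 1 ∧ r = subOpNorm U I J }

/-- The vector `W = (s₁, s₂ - s₁, …, s_d - s_{d-1})`. -/
noncomputable def Wvec {d : ℕ} (U : Matrix (Fin d) (Fin d) ℂ) : Fin d → ℝ :=
  fun k => sCoef U (k.val + 1) - (if k.val = 0 then 0 else sCoef U k.val)

/-- Tangent-line inequality for the convex function `t ↦ t ^ α / (α - 1)` on `(0, ∞)`. -/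
lemma rpow_div_tangent_le {α x y : ℝ} (hα0 : 0 < α) (hα1 : α ≠ 1) (hx : 0 < x) (hy : 0 < y) :
    α / (α - 1) * x ^ (α - 1) * (y - x) ≤ y ^ α / (α - 1) - x ^ α / (α - 1) := by
  have hs : -1 ≤ (y - x) / x := by
    rw [le_div_iff₀ hx]; linarith
  have hyx : 1 + (y - x) / x = y / x := by field_simp; ring
  have hxα : x ^ α = x ^ (α - 1) * x := by
    rw [← Real.rpow_add_one hx.ne']; simp
  have hpos : 0 < x ^ α := Real.rpow_pos_of_pos hx _
  have hyα : (y / x) ^ α * x ^ α = y ^ α := by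
    rw [Real.div_rpow hy.le hx.le]; field_simp
  have hlin : (1 + α * ((y - x) / x)) * x ^ α = x ^ α + α * x ^ (α - 1) * (y - x) := by
    rw [hxα]; field_simp
  rcases lt_or_gt_of_ne hα1 with h | h
  · have hb := rpow_one_add_le_one_add_mul_self hs hα0.le h.le
    rw [hyx] at hb
    have hm := mul_le_mul_of_nonneg_right hb hpos.le
    rw [hyα, hlin] at hm
    have h1 : α - 1 < 0 := by linarith
    rw [← sub_div, div_mul_eq_mul_div, div_mul_eq_mul_div,
      div_le_div_right_of_neg h1]
    linarith
  · have hb := one_add_mul_self_le_rpow_one_add hs h.le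
    rw [hyx] at hb
    have hm := mul_le_mul_of_nonneg_right hb hpos.le
    rw [hyα, hlin] at hm
    have h1 : 0 < α - 1 := by linarith
    rw [← sub_div, div_mul_eq_mul_div, div_mul_eq_mul_div,
      div_le_div_iff_of_pos_right h1]
    linarith

/-- The derivative of `t ↦ t ^ α / (α - 1)` is monotone on `(0, ∞)`. -/
lemma rpow_div_deriv_mono {α x y : ℝ} (hα0 : 0 < α) (hα1 : α ≠ 1) (hx : 0 < x) (hxy : x ≤ y) :
    α / (α - 1) * x ^ (α - 1) ≤ α / (α - 1) * y ^ (α - 1) := by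
  rcases lt_or_gt_of_ne hα1 with h | h
  · exact mul_le_mul_of_nonpos_left (Real.rpow_le_rpow_of_nonpos hx hxy (by linarith))
      (div_nonpos_of_nonneg_of_nonpos hα0.le (by linarith))
  · exact mul_le_mul_of_nonneg_left (Real.rpow_le_rpow hx.le hxy (by linarith))
      (div_nonneg hα0.le (by linarith))

/-- Karamata's inequality for `t ↦ t ^ α / (α - 1)` and positive sequences, the first of which
is sorted decreasingly. -/
lemma sum_rpow_div_le_of_pos {α : ℝ} (hα0 : 0 < α) (hα1 : α ≠ 1) (n : ℕ) (x y : ℕ → ℝ)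
    (hx : ∀ i < n, 0 < x i) (hy : ∀ i < n, 0 < y i)
    (hanti : ∀ i, i + 1 < n → x (i + 1) ≤ x i)
    (hle : ∀ k ≤ n, ∑ i ∈ Finset.range k, x i ≤ ∑ i ∈ Finset.range k, y i)
    (heq : ∑ i ∈ Finset.range n, x i = ∑ i ∈ Finset.range n, y i) :
    ∑ i ∈ Finset.range n, x i ^ α / (α - 1) ≤ ∑ i ∈ Finset.range n, y i ^ α / (α - 1) := by
  rw [← sub_nonneg, ← Finset.sum_sub_distrib]
  calc (0 : ℝ) ≤ ∑ i ∈ Finset.range n, (α / (α - 1) * x i ^ (α - 1)) • (y i - x i) := by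
        rw [Finset.sum_range_by_parts]
        simp only [Finset.sum_sub_distrib, heq, sub_self, mul_zero, zero_sub, smul_eq_mul]
        rw [neg_nonneg]
        refine Finset.sum_nonpos fun i hi => ?_
        have hi : i + 1 < n := by have := Finset.mem_range.1 hi; omega
        refine mul_nonpos_of_nonpos_of_nonneg
          (sub_nonpos.2 (rpow_div_deriv_mono hα0 hα1 (hx _ hi) (hanti i hi)))
          (sub_nonneg.2 (hle _ hi.le))
    _ ≤ _ := Finset.sum_le_sum fun i hi =>
        rpow_div_tangent_le hα0 hα1 (hx _ (Finset.mem_range.1 hi)) (hy _ (Finset.mem_range.1 hi))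

/-- Karamata's inequality for `t ↦ t ^ α / (α - 1)`: majorization is expressed by bounding the
sum of `x` over any finite set by the corresponding initial sum of `y`. -/
lemma sum_rpow_div_le_of_majorized {ι : Type*} [Fintype ι] {α : ℝ} (hα0 : 0 < α) (hα1 : α ≠ 1)
    (x : ι → ℝ) (y : ℕ → ℝ) (hx : ∀ i, 0 ≤ x i) (hy : ∀ i, 0 ≤ y i)
    (hle : ∀ s : Finset ι, ∑ i ∈ s, x i ≤ ∑ k ∈ Finset.range s.card, y k)
    (heq : ∑ i, x i = ∑ k ∈ Finset.range (Fintype.card ι), y k) :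
    ∑ i, x i ^ α / (α - 1) ≤ ∑ k ∈ Finset.range (Fintype.card ι), y k ^ α / (α - 1) := by
  set n := Fintype.card ι with hn
  obtain ⟨e, he⟩ : ∃ e : Fin n ≃ ι, Antitone (x ∘ e) := by
    let e₀ := (Fintype.equivFin ι).symm
    refine ⟨(Tuple.sort fun i => -x (e₀ i)).trans e₀, fun i j hij => ?_⟩
    simpa using Tuple.monotone_sort (fun i => -x (e₀ i)) hij
  let z : ℕ → ℝ := fun k => if h : k < n then x (e ⟨k, h⟩) else 0
  have hz : ∀ i : Fin n, z i = x (e i) := fun i => by simp [z]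
  have hsum : ∀ f : ℝ → ℝ, ∑ k ∈ Finset.range n, f (z k) = ∑ i, f (x i) := fun f => by
    rw [Finset.sum_range, ← e.sum_comp]
    simp [hz]
  have hzle : ∀ k ≤ n, ∑ i ∈ Finset.range k, z i ≤ ∑ i ∈ Finset.range k, y i := fun k hk => by
    have h := hle (Finset.univ.map ((Fin.castLEEmb hk).trans e.toEmbedding))
    simp only [Finset.sum_map, Finset.card_map, Finset.card_univ, Fintype.card_fin] at h
    rw [Finset.sum_range]
    convert h using 2 with i
    exact hz (Fin.castLE hk i)
  have hpos : ∀ ε > 0, ∑ i ∈ Finset.range n, (z i + ε) ^ α / (α - 1) ≤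
      ∑ i ∈ Finset.range n, (y i + ε) ^ α / (α - 1) := fun ε hε => by
    refine sum_rpow_div_le_of_pos hα0 hα1 n _ _ (fun i hi => ?_) (fun i _ => ?_) (fun i hi => ?_)
      (fun k hk => ?_) ?_
    · have := hx (e ⟨i, hi⟩)
      simp only [z, hi, dite_true]
      linarith
    · linarith [hy i]
    · have := he (show (⟨i, by omega⟩ : Fin n) ≤ ⟨i + 1, hi⟩ by simp)
      simpa [z, hi, show i < n by omega] using this
    · simpa [Finset.sum_add_distrib] using hzle k hk
    · simpa [Finset.sum_add_distrib, heq] using hsum id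
  have hlim : ∀ u : ℕ → ℝ, Filter.Tendsto
      (fun ε : ℝ => ∑ i ∈ Finset.range n, (u i + ε) ^ α / (α - 1)) (nhdsWithin 0 (Set.Ioi 0))
      (nhds (∑ i ∈ Finset.range n, u i ^ α / (α - 1))) := fun u => by
    have hc : Continuous fun ε : ℝ => ∑ i ∈ Finset.range n, (u i + ε) ^ α / (α - 1) := by
      refine continuous_finsetSum _ fun i _ => Continuous.div_const ?_ _
      exact (continuous_const.add continuous_id).rpow_const fun _ => Or.inr hα0.le
    simpa using (hc.tendsto 0).mono_left nhdsWithin_le_nhds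
  rw [← hsum fun t => t ^ α / (α - 1)]
  exact le_of_tendsto_of_tendsto (hlim z) (hlim y)
    (Filter.eventually_of_mem self_mem_nhdsWithin hpos)

/-- A bound on `‖a‖² + ‖b‖²` for projections `a`, `b` of `v` onto two subspaces with
cosine at most `s`. -/
lemma norm_sq_add_norm_sq_le_of_inner {E : Type*} [NormedAddCommGroup E] [InnerProductSpace ℂ E]
    {s : ℝ} (hs : 0 ≤ s) {v a b : E} (ha : inner ℂ v a = (‖a‖ ^ 2 : ℂ))
    (hb : inner ℂ v b = (‖b‖ ^ 2 : ℂ)) (hab : ‖inner ℂ a b‖ ≤ s * ‖a‖ * ‖b‖) :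
    ‖a‖ ^ 2 + ‖b‖ ^ 2 ≤ (1 + s) * ‖v‖ ^ 2 := by
  set t := ‖a‖ ^ 2 + ‖b‖ ^ 2 with ht
  have hsum : t ≤ ‖v‖ * ‖a + b‖ := by
    have h : inner ℂ v (a + b) = (t : ℂ) := by
      rw [inner_add_right, ha, hb, ht]; push_cast; rfl
    have hn := norm_inner_le_norm (𝕜 := ℂ) v (a + b)
    rw [h, Complex.norm_real] at hn
    exact (le_abs_self t).trans hn
  have hsq : ‖a + b‖ ^ 2 ≤ (1 + s) * t := by
    rw [norm_add_sq (𝕜 := ℂ)]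
    have h1 : RCLike.re (inner ℂ a b) ≤ s * ‖a‖ * ‖b‖ := (RCLike.re_le_norm _).trans hab
    nlinarith [mul_nonneg hs (sq_nonneg (‖a‖ - ‖b‖))]
  rcases (show 0 ≤ t by positivity).eq_or_lt with h0 | h0
  · rw [← h0]; positivity
  · have h2 : t ^ 2 ≤ ‖v‖ ^ 2 * ((1 + s) * t) := calc
      t ^ 2 ≤ (‖v‖ * ‖a + b‖) ^ 2 := pow_le_pow_left₀ h0.le hsum 2
      _ = ‖v‖ ^ 2 * ‖a + b‖ ^ 2 := mul_pow _ _ _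
      _ ≤ _ := mul_le_mul_of_nonneg_left hsq (sq_nonneg _)
    exact le_of_mul_le_mul_right (by nlinarith) h0

section SubmatrixNorm

variable {d : ℕ} {U : Matrix (Fin d) (Fin d) ℂ}

/-- A unitary matrix preserves the Euclidean norm. -/
lemma norm_toLp_mulVec_of_mem_unitaryGroup (hU : U ∈ Matrix.unitaryGroup (Fin d) ℂ)
    (y : Fin d → ℂ) : ‖WithLp.toLp 2 (U *ᵥ y)‖ = ‖WithLp.toLp 2 y‖ := by
  have h : inner ℂ (WithLp.toLp 2 (U *ᵥ y)) (WithLp.toLp 2 (U *ᵥ y)) =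
      inner ℂ (WithLp.toLp 2 y) (WithLp.toLp 2 y) := by
    simp only [EuclideanSpace.inner_toLp_toLp]
    have hU' : Uᴴ * U = 1 := Matrix.mem_unitaryGroup_iff'.1 hU
    rw [dotProduct_comm, Matrix.star_mulVec, Matrix.dotProduct_mulVec, Matrix.vecMul_vecMul, hU',
      Matrix.vecMul_one, dotProduct_comm]
  rw [inner_self_eq_norm_sq_to_K, inner_self_eq_norm_sq_to_K] at h
  exact (sq_eq_sq₀ (norm_nonneg _) (norm_nonneg _)).1 (by exact_mod_cast h)

lemma norm_star_dotProduct_mulVec_le (hU : U ∈ Matrix.unitaryGroup (Fin d) ℂ)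
    (x y : Fin d → ℂ) :
    ‖star x ⬝ᵥ (U *ᵥ y)‖ ≤ ‖WithLp.toLp 2 x‖ * ‖WithLp.toLp 2 y‖ := by
  have h := norm_inner_le_norm (𝕜 := ℂ) (WithLp.toLp 2 x) (WithLp.toLp 2 (U *ᵥ y))
  rwa [EuclideanSpace.inner_toLp_toLp, dotProduct_comm,
    norm_toLp_mulVec_of_mem_unitaryGroup hU] at h

lemma sum_subtype_eq_star_dotProduct_mulVec (I J : Finset (Fin d)) {x y : Fin d → ℂ}
    (hx : ∀ i ∉ I, x i = 0) (hy : ∀ j ∉ J, y j = 0) :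
    ∑ i : I, ∑ j : J, (starRingEnd ℂ) (x i) * U i.1 j.1 * y j = star x ⬝ᵥ (U *ᵥ y) := by
  have hJ : ∀ i, ∑ j : J, (starRingEnd ℂ) (x i) * U i j.1 * y j
      = ∑ j, (starRingEnd ℂ) (x i) * U i j * y j := fun i => by
    rw [Finset.sum_coe_sort J fun j => (starRingEnd ℂ) (x i) * U i j * y j]
    exact Finset.sum_subset (Finset.subset_univ _) fun j _ hj => by simp [hy j hj]
  simp only [hJ]
  rw [Finset.sum_coe_sort I fun i => ∑ j, (starRingEnd ℂ) (x i) * U i j * y j,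
    Finset.sum_subset (Finset.subset_univ I) fun i _ hi => by simp [hx i hi]]
  simp [dotProduct, Matrix.mulVec, Finset.mul_sum, mul_assoc]

lemma sum_subtype_norm_sq_eq (I : Finset (Fin d)) {x : Fin d → ℂ} (hx : ∀ i ∉ I, x i = 0) :
    ∑ i : I, ‖x i‖ ^ 2 = ‖WithLp.toLp 2 x‖ ^ 2 := by
  rw [EuclideanSpace.norm_sq_eq, Finset.sum_coe_sort I fun i => ‖x i‖ ^ 2]
  exact Finset.sum_subset (Finset.subset_univ _) fun i _ hi => by simp [hx i hi]

lemma exists_extend_by_zero (I : Finset (Fin d)) (x : I → ℂ) :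
    ∃ x' : Fin d → ℂ, (∀ i ∉ I, x' i = 0) ∧ ∀ i : I, x' i = x i :=
  ⟨fun i => if h : i ∈ I then x ⟨i, h⟩ else 0, fun i hi => by simp [hi], fun i => by simp⟩

lemma subOpNorm_nonneg (I J : Finset (Fin d)) : 0 ≤ subOpNorm U I J :=
  Real.sSup_nonneg <| by rintro _ ⟨x, y, -, -, rfl⟩; exact norm_nonneg _

/-- The variational description of `subOpNorm` by vectors supported on `I` and `J`. -/
lemma subOpNorm_set_eq (I J : Finset (Fin d)) :
    { r : ℝ | ∃ (x : I → ℂ) (y : J → ℂ), (∑ i, ‖x i‖ ^ 2 = 1) ∧ (∑ j, ‖y j‖ ^ 2 = 1) ∧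
      r = ‖∑ i : I, ∑ j : J, (starRingEnd ℂ) (x i) * U i.1 j.1 * y j‖ } =
    { r : ℝ | ∃ x y : Fin d → ℂ, (∀ i ∉ I, x i = 0) ∧ (∀ j ∉ J, y j = 0) ∧
      ‖WithLp.toLp 2 x‖ = 1 ∧ ‖WithLp.toLp 2 y‖ = 1 ∧ r = ‖star x ⬝ᵥ (U *ᵥ y)‖ } := by
  have hone : ∀ t : EuclideanSpace ℂ (Fin d), ‖t‖ ^ 2 = 1 ↔ ‖t‖ = 1 := fun t =>
    pow_eq_one_iff_of_nonneg (norm_nonneg t) two_ne_zero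
  ext r
  constructor
  · rintro ⟨x, y, hx, hy, rfl⟩
    obtain ⟨x', hx0, hx'⟩ := exists_extend_by_zero I x
    obtain ⟨y', hy0, hy'⟩ := exists_extend_by_zero J y
    simp only [← hx', ← hy'] at hx hy ⊢
    rw [sum_subtype_norm_sq_eq I hx0, hone] at hx
    rw [sum_subtype_norm_sq_eq J hy0, hone] at hy
    exact ⟨x', y', hx0, hy0, hx, hy, by rw [sum_subtype_eq_star_dotProduct_mulVec I J hx0 hy0]⟩
  · rintro ⟨x, y, hx0, hy0, hx, hy, rfl⟩
    exact ⟨fun i => x i, fun j => y j, by rw [sum_subtype_norm_sq_eq I hx0, hx, one_pow],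
      by rw [sum_subtype_norm_sq_eq J hy0, hy, one_pow],
      by rw [sum_subtype_eq_star_dotProduct_mulVec I J hx0 hy0]⟩

lemma subOpNorm_le_of_forall {I J : Finset (Fin d)} {c : ℝ} (hc : 0 ≤ c)
    (h : ∀ x y : Fin d → ℂ, (∀ i ∉ I, x i = 0) → (∀ j ∉ J, y j = 0) →
      ‖WithLp.toLp 2 x‖ = 1 → ‖WithLp.toLp 2 y‖ = 1 → ‖star x ⬝ᵥ (U *ᵥ y)‖ ≤ c) :
    subOpNorm U I J ≤ c := by
  rw [subOpNorm, subOpNorm_set_eq]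
  refine Real.sSup_le ?_ hc
  rintro _ ⟨x, y, hx0, hy0, hx, hy, rfl⟩
  exact h x y hx0 hy0 hx hy

lemma subOpNorm_le_one (hU : U ∈ Matrix.unitaryGroup (Fin d) ℂ) (I J : Finset (Fin d)) :
    subOpNorm U I J ≤ 1 :=
  subOpNorm_le_of_forall zero_le_one fun x y _ _ hx hy => by
    simpa [hx, hy] using norm_star_dotProduct_mulVec_le hU x y

lemma norm_star_dotProduct_mulVec_le_subOpNorm (hU : U ∈ Matrix.unitaryGroup (Fin d) ℂ)
    {I J : Finset (Fin d)} {x y : Fin d → ℂ} (hx : ∀ i ∉ I, x i = 0) (hy : ∀ j ∉ J, y j = 0) :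
    ‖star x ⬝ᵥ (U *ᵥ y)‖ ≤ subOpNorm U I J * ‖WithLp.toLp 2 x‖ * ‖WithLp.toLp 2 y‖ := by
  have hle := norm_star_dotProduct_mulVec_le hU x y
  rcases (norm_nonneg (WithLp.toLp 2 x)).eq_or_lt with hx1 | hx1
  · rw [← hx1] at hle ⊢; simpa using hle
  rcases (norm_nonneg (WithLp.toLp 2 y)).eq_or_lt with hy1 | hy1
  · rw [← hy1] at hle ⊢; simpa using hle
  set a := ‖WithLp.toLp 2 x‖
  set b := ‖WithLp.toLp 2 y‖
  have hmem : ‖star (((a⁻¹ : ℝ) : ℂ) • x) ⬝ᵥ (U *ᵥ (((b⁻¹ : ℝ) : ℂ) • y))‖ ≤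
      subOpNorm U I J := by
    rw [subOpNorm, subOpNorm_set_eq]
    refine le_csSup ⟨1, ?_⟩ ⟨_, _, fun i hi => by simp [hx i hi], fun j hj => by simp [hy j hj],
      ?_, ?_, rfl⟩
    · rintro _ ⟨x, y, -, -, hx, hy, rfl⟩
      simpa [hx, hy] using norm_star_dotProduct_mulVec_le hU x y
    · rw [WithLp.toLp_smul, norm_smul, Complex.norm_real, norm_inv, norm_norm,
        inv_mul_cancel₀ hx1.ne']
    · rw [WithLp.toLp_smul, norm_smul, Complex.norm_real, norm_inv, norm_norm,
        inv_mul_cancel₀ hy1.ne']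
  rw [star_smul, Matrix.mulVec_smul, smul_dotProduct, dotProduct_smul, norm_smul, norm_smul,
    norm_star, Complex.norm_real, Complex.norm_real, norm_inv, norm_inv, Real.norm_of_nonneg hx1.le,
    Real.norm_of_nonneg hy1.le, ← mul_assoc, ← mul_inv, inv_mul_le_iff₀ (by positivity)] at hmem
  linarith

lemma subOpNorm_mono (hU : U ∈ Matrix.unitaryGroup (Fin d) ℂ) {I I' J J' : Finset (Fin d)}
    (hI : I ⊆ I') (hJ : J ⊆ J') : subOpNorm U I J ≤ subOpNorm U I' J' :=
  subOpNorm_le_of_forall (subOpNorm_nonneg _ _) fun x y hx0 hy0 hx hy => by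
    simpa [hx, hy] using norm_star_dotProduct_mulVec_le_subOpNorm hU
      (fun i hi => hx0 i (mt (@hI i) hi)) (fun j hj => hy0 j (mt (@hJ j) hj))

lemma sCoef_nonneg (k : ℕ) : 0 ≤ sCoef U k :=
  Real.sSup_nonneg <| by rintro _ ⟨I, J, -, -, -, rfl⟩; exact subOpNorm_nonneg _ _

lemma subOpNorm_le_sCoef (hU : U ∈ Matrix.unitaryGroup (Fin d) ℂ) {I J : Finset (Fin d)} {k : ℕ}
    (hI : I.Nonempty) (hJ : J.Nonempty) (hIJ : I.card + J.card = k + 1) :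
    subOpNorm U I J ≤ sCoef U k :=
  le_csSup ⟨1, by rintro _ ⟨I, J, -, -, -, rfl⟩; exact subOpNorm_le_one hU I J⟩
    ⟨I, J, hI, hJ, hIJ, rfl⟩

lemma sCoef_le_one (hU : U ∈ Matrix.unitaryGroup (Fin d) ℂ) (k : ℕ) : sCoef U k ≤ 1 :=
  Real.sSup_le (by rintro _ ⟨I, J, -, -, -, rfl⟩; exact subOpNorm_le_one hU I J) zero_le_one

lemma sCoef_zero : sCoef U 0 = 0 := by
  refine le_antisymm (Real.sSup_le ?_ le_rfl) (sCoef_nonneg 0)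
  rintro _ ⟨I, J, hI, hJ, h, -⟩
  have := hI.card_pos
  have := hJ.card_pos
  omega

lemma sCoef_le_succ (hU : U ∈ Matrix.unitaryGroup (Fin d) ℂ) {k : ℕ} (hk : k < d) :
    sCoef U k ≤ sCoef U (k + 1) := by
  refine Real.sSup_le ?_ (sCoef_nonneg _)
  rintro _ ⟨I, J, hI, hJ, h, rfl⟩
  have := hJ.card_pos
  obtain ⟨i, hi⟩ : ∃ i, i ∉ I := by
    by_contra! hall
    rw [Finset.eq_univ_iff_forall.2 hall, Finset.card_univ, Fintype.card_fin] at h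
    omega
  refine (subOpNorm_mono hU (Finset.subset_insert i I) subset_rfl).trans
    (subOpNorm_le_sCoef hU (Finset.insert_nonempty i I) hJ ?_)
  rw [Finset.card_insert_of_notMem hi]
  omega

lemma sCoef_dim (hd : 0 < d) (hU : U ∈ Matrix.unitaryGroup (Fin d) ℂ) : sCoef U d = 1 := by
  refine le_antisymm (sCoef_le_one hU d) ?_
  let j : Fin d := ⟨0, hd⟩
  let y : Fin d → ℂ := Pi.single j 1
  have hy : ‖WithLp.toLp 2 y‖ = 1 := by simp [y]
  have h := norm_star_dotProduct_mulVec_le_subOpNorm hU (I := Finset.univ) (J := {j})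
    (x := U *ᵥ y) (y := y) (by simp) (fun i hi => by simp_all [y])
  rw [norm_toLp_mulVec_of_mem_unitaryGroup hU, hy, dotProduct_comm,
    ← EuclideanSpace.inner_toLp_toLp, inner_self_eq_norm_sq_to_K,
    norm_toLp_mulVec_of_mem_unitaryGroup hU, hy] at h
  have : Nonempty (Fin d) := ⟨j⟩
  refine le_trans (by simpa using h) (subOpNorm_le_sCoef hU (I := Finset.univ) (J := {j})
    Finset.univ_nonempty (Finset.singleton_nonempty j) (by simp))

lemma norm_sq_toLp_restrict (I : Finset (Fin d)) (v : Fin d → ℂ) :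
    ‖WithLp.toLp 2 fun i => if i ∈ I then v i else 0‖ ^ 2 = ∑ i ∈ I, ‖v i‖ ^ 2 := by
  simp [EuclideanSpace.norm_sq_eq, apply_ite, ite_pow, Finset.sum_ite_mem]

lemma star_dotProduct_restrict (I : Finset (Fin d)) (v : Fin d → ℂ) :
    (star v ⬝ᵥ fun i => if i ∈ I then v i else 0) =
      ((∑ i ∈ I, ‖v i‖ ^ 2 : ℝ) : ℂ) := by
  simp [dotProduct, Finset.sum_ite_mem, Complex.conj_mul']

/-- The joint bound for a single vector measured in both bases. -/
lemma sum_norm_sq_add_sum_norm_sq_le (hU : U ∈ Matrix.unitaryGroup (Fin d) ℂ)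
    (I J : Finset (Fin d)) (v : Fin d → ℂ) :
    ∑ i ∈ I, ‖v i‖ ^ 2 + ∑ j ∈ J, ‖(Uᴴ *ᵥ v) j‖ ^ 2 ≤
      (1 + subOpNorm U I J) * ∑ i, ‖v i‖ ^ 2 := by
  let x : Fin d → ℂ := fun i => if i ∈ I then v i else 0
  let y : Fin d → ℂ := fun j => if j ∈ J then (Uᴴ *ᵥ v) j else 0
  have hx : ‖WithLp.toLp 2 x‖ ^ 2 = ∑ i ∈ I, ‖v i‖ ^ 2 := norm_sq_toLp_restrict I v
  have hy : ‖WithLp.toLp 2 (U *ᵥ y)‖ ^ 2 = ∑ j ∈ J, ‖(Uᴴ *ᵥ v) j‖ ^ 2 := by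
    rw [norm_toLp_mulVec_of_mem_unitaryGroup hU]
    exact norm_sq_toLp_restrict J _
  have hv : ‖WithLp.toLp 2 v‖ ^ 2 = ∑ i, ‖v i‖ ^ 2 := EuclideanSpace.norm_sq_eq _
  rw [← hx, ← hy, ← hv]
  refine norm_sq_add_norm_sq_le_of_inner (subOpNorm_nonneg I J) ?_ ?_ ?_
  · rw [EuclideanSpace.inner_toLp_toLp, dotProduct_comm, ← Complex.ofReal_pow, hx]
    exact star_dotProduct_restrict I v
  · rw [EuclideanSpace.inner_toLp_toLp, dotProduct_comm, ← Complex.ofReal_pow, hy,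
      Matrix.dotProduct_mulVec, ← star_dotProduct_restrict J, Matrix.star_mulVec,
      Matrix.conjTranspose_conjTranspose]
  · rw [EuclideanSpace.inner_toLp_toLp, dotProduct_comm, norm_toLp_mulVec_of_mem_unitaryGroup hU]
    exact norm_star_dotProduct_mulVec_le_subOpNorm hU (fun i hi => by simp [x, hi])
      (fun j hj => by simp [y, hj])

lemma re_vecMulVec_star_diag (v : Fin d → ℂ) (i : Fin d) :
    (Matrix.vecMulVec v (star v) i i).re = ‖v i‖ ^ 2 := by
  simp [Matrix.vecMulVec_apply, Complex.mul_conj', ← Complex.ofReal_pow]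

lemma conjTranspose_mul_vecMulVec_star_mul (v : Fin d → ℂ) :
    Uᴴ * Matrix.vecMulVec v (star v) * U =
      Matrix.vecMulVec (Uᴴ *ᵥ v) (star (Uᴴ *ᵥ v)) := by
  rw [Matrix.mul_vecMulVec, Matrix.vecMulVec_mul, Matrix.star_mulVec,
    Matrix.conjTranspose_conjTranspose]

/-- The joint bound for a positive semidefinite matrix measured in both bases. -/
lemma sum_re_diag_add_sum_re_diag_le (hU : U ∈ Matrix.unitaryGroup (Fin d) ℂ)
    {ρ : Matrix (Fin d) (Fin d) ℂ} (hρ : ρ.PosSemidef) (I J : Finset (Fin d)) :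
    ∑ i ∈ I, (ρ i i).re + ∑ j ∈ J, ((Uᴴ * ρ * U) j j).re ≤
      (1 + subOpNorm U I J) * ρ.trace.re := by
  obtain ⟨m, v, rfl⟩ := Matrix.posSemidef_iff_eq_sum_vecMulVec.1 hρ
  simp only [Matrix.mul_sum, Matrix.sum_mul, conjTranspose_mul_vecMulVec_star_mul, Matrix.trace,
    Matrix.diag, Matrix.sum_apply, Complex.re_sum, re_vecMulVec_star_diag]
  rw [Finset.sum_comm, Finset.sum_comm (s := J), Finset.sum_comm (s := Finset.univ (α := Fin d)),
    ← Finset.sum_add_distrib, Finset.mul_sum]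
  exact Finset.sum_le_sum fun k _ => sum_norm_sq_add_sum_norm_sq_le hU I J (v k)

end SubmatrixNorm

/-- **Direct-sum majorization entropic uncertainty relation (Tsallis case)**: for any
order `α > 0`, `α ≠ 1`, one has `T_α(p) + T_α(q) ≥ T_α(W)` with
`W = (s₁, s₂ - s₁, …, s_d - s_{d-1})`. -/
theorem stmt_9 (d : ℕ) (hd : 2 ≤ d)
    (U : Matrix (Fin d) (Fin d) ℂ) (hU : U ∈ Matrix.unitaryGroup (Fin d) ℂ)
    (ρ : Matrix (Fin d) (Fin d) ℂ) (hρ : ρ.PosSemidef) (hρtr : ρ.trace = 1)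
    (p q : Fin d → ℝ)
    (hp : ∀ i, p i = (ρ i i).re)
    (hq : ∀ j, q j = ((Uᴴ * ρ * U) j j).re)
    (α : ℝ) (hα0 : 0 < α) (hα1 : α ≠ 1) :
    tsallisEntropy α p + tsallisEntropy α q ≥ tsallisEntropy α (Wvec U) := by
  have hp0 : ∀ i, 0 ≤ p i := fun i => by
    rw [hp]; exact (Complex.nonneg_iff.1 hρ.diag_nonneg).1
  have hq0 : ∀ j, 0 ≤ q j := fun j => by
    rw [hq]; exact (Complex.nonneg_iff.1 (hρ.conjTranspose_mul_mul_same U).diag_nonneg).1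
  have hp1 : ∑ i, p i = 1 := by
    simp only [hp, ← Complex.re_sum]
    exact congrArg Complex.re hρtr
  have hq1 : ∑ j, q j = 1 := by
    have htr : (Uᴴ * ρ * U).trace = 1 := by
      have hU' : U * Uᴴ = 1 := Matrix.mem_unitaryGroup_iff.1 hU
      rw [Matrix.trace_mul_comm, ← mul_assoc, hU', one_mul, hρtr]
    simp only [hq, ← Complex.re_sum]
    exact congrArg Complex.re htr
  have hpq : ∀ I J : Finset (Fin d), ∑ i ∈ I, p i + ∑ j ∈ J, q j ≤ 1 + subOpNorm U I J :=
    fun I J => by simpa [hp, hq, hρtr] using sum_re_diag_add_sum_re_diag_le hU hρ I J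
  have hpI : ∀ I : Finset (Fin d), ∑ i ∈ I, p i ≤ 1 := fun I =>
    hp1 ▸ Finset.sum_le_univ_sum_of_nonneg hp0
  have hqJ : ∀ J : Finset (Fin d), ∑ j ∈ J, q j ≤ 1 := fun J =>
    hq1 ▸ Finset.sum_le_univ_sum_of_nonneg hq0
  -- the vector `(1, W₁, …, W_d, 0, 0, …)`
  let s : ℕ → ℝ := fun k => sCoef U (min k d)
  let y : ℕ → ℝ := fun k => Nat.casesOn k 1 fun k => s (k + 1) - s k
  have hs0 : s 0 = 0 := by simp [s, sCoef_zero]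
  have hsd : ∀ k, d ≤ k → s k = 1 := fun k hk => by
    simp [s, hk, sCoef_dim (by omega : 0 < d) hU]
  have hsmono : ∀ k, s k ≤ s (k + 1) := fun k => by
    rcases lt_or_ge k d with h | h
    · simpa [s, h.le, Nat.succ_le_of_lt h] using sCoef_le_succ hU h
    · rw [hsd k h, hsd (k + 1) (by omega)]
  have hy0 : ∀ k, 0 ≤ y k
    | 0 => zero_le_one
    | k + 1 => sub_nonneg.2 (hsmono k)
  have hysum : ∀ k, ∑ i ∈ Finset.range (k + 1), y i = 1 + s k := fun k => by
    rw [Finset.sum_range_succ', Finset.sum_range_sub, hs0, sub_zero]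
    exact add_comm (s k) 1
  have hyW : ∀ k : Fin d, y (k + 1) = Wvec U k := fun k => by
    have h1 : min (k.val + 1) d = k + 1 := by omega
    have h2 : min k.val d = k := by omega
    simp only [y, s, Wvec, h1, h2]
    split_ifs with h
    · rw [h, sCoef_zero]
    · rfl
  have hmaj : ∀ t : Finset (Fin d ⊕ Fin d),
      ∑ i ∈ t, Sum.elim p q i ≤ ∑ k ∈ Finset.range t.card, y k := fun t => by
    rw [← Finset.toLeft_disjSum_toRight (u := t), Finset.sum_disjSum, Finset.card_disjSum]
    simp only [Sum.elim_inl, Sum.elim_inr]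
    generalize t.toLeft = I, t.toRight = J
    have hs_nonneg : ∀ k, 0 ≤ s k := fun k => sCoef_nonneg _
    rcases I.eq_empty_or_nonempty with rfl | hI
    · rcases J.eq_empty_or_nonempty with rfl | hJ
      · simp
      · obtain ⟨k, hk⟩ := Nat.exists_eq_succ_of_ne_zero hJ.card_pos.ne'
        rw [Finset.card_empty, zero_add, hk, hysum, Finset.sum_empty, zero_add]
        linarith [hqJ J, hs_nonneg k]
    · obtain ⟨k, hk⟩ := Nat.exists_eq_succ_of_ne_zero
        (show I.card + J.card ≠ 0 by have := hI.card_pos; omega)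
      rw [hk, hysum]
      rcases J.eq_empty_or_nonempty with rfl | hJ
      · rw [Finset.sum_empty, add_zero]
        linarith [hpI I, hs_nonneg k]
      · rcases le_total d k with h | h
        · rw [hsd k h]
          exact add_le_add (hpI I) (hqJ J)
        · refine (hpq I J).trans (add_le_add_right ?_ 1)
          simpa [s, h] using subOpNorm_le_sCoef hU hI hJ hk
  have hcard : Fintype.card (Fin d ⊕ Fin d) = d + 1 + (d - 1) := by
    simp only [Fintype.card_sum, Fintype.card_fin]; omega
  have hkar := sum_rpow_div_le_of_majorized hα0 hα1 (Sum.elim p q) y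
    (by rintro (i | j); exacts [hp0 i, hq0 j]) hy0 hmaj (by
      rw [Fintype.sum_sum_type, hcard, show d + 1 + (d - 1) = (2 * d - 1) + 1 by omega, hysum,
        hsd _ (by omega)]
      simp [hp1, hq1])
  have htail : ∀ k, y (d + 1 + k) = 0 := fun k => by
    rw [show d + 1 + k = (d + k) + 1 by ring]
    simp only [y]
    rw [hsd _ (by omega), hsd _ (by omega), sub_self]
  have hyα : ∑ k ∈ Finset.range (d + 1 + (d - 1)), y k ^ α / (α - 1) =
      1 / (α - 1) + ∑ k, Wvec U k ^ α / (α - 1) := by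
    rw [Finset.sum_range_add, Finset.sum_range_succ', Finset.sum_range]
    simp only [htail, Real.zero_rpow hα0.ne', zero_div, Finset.sum_const_zero, add_zero, hyW]
    simp [y, add_comm]
  rw [hcard, hyα, Fintype.sum_sum_type] at hkar
  simp only [Sum.elim_inl, Sum.elim_inr, ← Finset.sum_div] at hkar
  have hinv : 1 / (1 - α) = -(1 / (α - 1)) := by
    rw [← neg_sub α 1, one_div_neg_eq_neg_one_div]
  simp only [tsallisEntropy, hinv]
  simp only [div_eq_mul_inv, one_mul] at hkar ⊢
  linarith
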